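/- For every k ≥ 3 there exists a set of 2^(k−2) points in the plane in general position containing no k points in convex position; hence ES(k) ≥ 2^(k−2) + 1. -/

import Mathlib

def GenPos (S : Set (ℝ × ℝ)) : Prop :=
  ∀ a ∈ S, ∀ b ∈ S, ∀ c ∈ S, a ≠ b → a ≠ c → b ≠ c →
    ¬ Collinear ℝ ({a, b, c} : Set (ℝ × ℝ))

def ConvexPos (S : Set (ℝ × ℝ)) : Prop :=
  ∀ p ∈ S, p ∉ convexHull ℝ (S \ {p})

noncomputable def det2 (a b c : ℝ × ℝ) : ℝ :=
  (b.1 - a.1) * (c.2 - a.2) - (b.2 - a.2) * (c.1 - a.1)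

noncomputable def chi (a b c : ℝ × ℝ) : ℝ := Real.sign (det2 a b c)

def HasConvex (S : Set (ℝ × ℝ)) (k : ℕ) : Prop :=
  ∃ T ⊆ S, T.ncard = k ∧ ConvexPos T

noncomputable def ES (k : ℕ) : ℕ :=
  sInf {N : ℕ | ∀ S : Set (ℝ × ℝ), S.Finite → N ≤ S.ncard → GenPos S → HasConvex S k}

/-- Every triple of `T`, read from left to right, has orientation of the sign of `s`:
`Turns 1` describes cups and `Turns (-1)` describes caps. -/
def Turns (s : ℝ) (T : Finset (ℝ × ℝ)) : Prop :=
  ∀ a ∈ T, ∀ b ∈ T, ∀ c ∈ T, a.1 < b.1 → b.1 < c.1 → 0 < s * det2 a b c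

/-- Distinct points have distinct abscissas, and no three points are collinear. -/
def Generic (S : Finset (ℝ × ℝ)) : Prop :=
  Set.InjOn Prod.fst (S : Set (ℝ × ℝ)) ∧
    ∀ a ∈ S, ∀ b ∈ S, ∀ c ∈ S, a.1 < b.1 → b.1 < c.1 → det2 a b c ≠ 0

/-- No point of `T` lies in the interior of a triangle spanned by points of `T`. -/
def NoInterior (T : Finset (ℝ × ℝ)) : Prop :=
  ∀ a ∈ T, ∀ b ∈ T, ∀ c ∈ T, ∀ p ∈ T,
    0 < det2 a b p → 0 < det2 b c p → ¬ 0 < det2 c a p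

theorem Turns.subset {s : ℝ} {T U : Finset (ℝ × ℝ)} (h : Turns s U) (hTU : T ⊆ U) :
    Turns s T :=
  fun a ha b hb c hc => h a (hTU ha) b (hTU hb) c (hTU hc)

theorem Generic.subset {T U : Finset (ℝ × ℝ)} (h : Generic U) (hTU : T ⊆ U) : Generic T :=
  ⟨h.1.mono (Finset.coe_subset.2 hTU),
    fun a ha b hb c hc => h.2 a (hTU ha) b (hTU hb) c (hTU hc)⟩

theorem Generic.fst_lt_or_lt {S : Finset (ℝ × ℝ)} (h : Generic S) {a b : ℝ × ℝ}
    (ha : a ∈ S) (hb : b ∈ S) (hab : a ≠ b) : a.1 < b.1 ∨ b.1 < a.1 :=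
  lt_or_gt_of_ne fun e => hab (h.1 ha hb e)

theorem det2_swap_left (a b c : ℝ × ℝ) : det2 b a c = -det2 a b c := by
  unfold det2; ring

theorem det2_rotate (a b c : ℝ × ℝ) : det2 b c a = det2 a b c := by
  unfold det2; ring

theorem det2_eq_zero_of_collinear {a b c : ℝ × ℝ}
    (h : Collinear ℝ ({a, b, c} : Set (ℝ × ℝ))) : det2 a b c = 0 := by
  obtain ⟨v, hv⟩ := (collinear_iff_of_mem (p₀ := a) (by simp)).1 h
  obtain ⟨r, hr⟩ := hv b (by simp)
  obtain ⟨t, ht⟩ := hv c (by simp)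
  subst hr ht
  simp [det2]
  ring

theorem collinear_of_det2_eq_zero {a b c : ℝ × ℝ} (hab : a.1 ≠ b.1) (h : det2 a b c = 0) :
    Collinear ℝ ({a, b, c} : Set (ℝ × ℝ)) := by
  refine (collinear_iff_of_mem (p₀ := a) (by simp)).2 ⟨b - a, ?_⟩
  have hne : b.1 - a.1 ≠ 0 := sub_ne_zero.2 hab.symm
  intro p hp
  simp only [Set.mem_insert_iff, Set.mem_singleton_iff] at hp
  rcases hp with rfl | rfl | rfl
  · exact ⟨0, by simp⟩
  · exact ⟨1, by simp⟩
  · refine ⟨(p.1 - a.1) / (b.1 - a.1), ?_⟩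
    unfold det2 at h
    ext
    · simp
      field_simp
      ring
    · simp
      field_simp
      linarith

theorem collinear_of_fst_eq {a b c : ℝ × ℝ} (hab : b.1 = a.1) (hac : c.1 = a.1) :
    Collinear ℝ ({a, b, c} : Set (ℝ × ℝ)) := by
  refine (collinear_iff_of_mem (p₀ := a) (by simp)).2 ⟨(0, 1), ?_⟩
  intro p hp
  simp only [Set.mem_insert_iff, Set.mem_singleton_iff] at hp
  refine ⟨p.2 - a.2, ?_⟩
  rcases hp with rfl | rfl | rfl <;> ext <;> simp [*]

theorem Generic.genPos {S : Finset (ℝ × ℝ)} (h : Generic S) : GenPos (S : Set (ℝ × ℝ)) := by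
  intro a ha b hb c hc hab hac hbc hcol
  have h0 := det2_eq_zero_of_collinear hcol
  have h1 := det2_swap_left a b c
  have h2 := det2_rotate a b c
  have h3 := det2_rotate b c a
  have h4 := det2_rotate b a c
  have h5 := det2_rotate a c b
  rw [Finset.mem_coe] at ha hb hc
  have key := h.2
  rcases h.fst_lt_or_lt ha hb hab with p | p <;> rcases h.fst_lt_or_lt ha hc hac with q | q <;>
    rcases h.fst_lt_or_lt hb hc hbc with r | r
  · exact key a ha b hb c hc p r h0
  · exact key a ha c hc b hb q r (by linarith)
  · linarith
  · exact key c hc a ha b hb q p (by linarith)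
  · exact key b hb a ha c hc p q (by linarith)
  · linarith
  · exact key b hb c hc a ha r q (by linarith)
  · exact key c hc b hb a ha r p (by linarith)

theorem ConvexPos.noInterior {T : Finset (ℝ × ℝ)} (h : ConvexPos (T : Set (ℝ × ℝ))) :
    NoInterior T := by
  intro a ha b hb c hc p hp h1 h2 h3
  refine h p hp ?_
  have hpa : a ≠ p := by rintro rfl; simp [det2, mul_comm] at h3
  have hpb : b ≠ p := by rintro rfl; simp [det2] at h2
  have hpc : c ≠ p := by rintro rfl; simp [det2] at h3
  have hconv := convex_convexHull ℝ ((T : Set (ℝ × ℝ)) \ {p})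
  have hsub := subset_convexHull ℝ ((T : Set (ℝ × ℝ)) \ {p})
  set d := det2 a b p + det2 b c p + det2 c a p with hd
  have hdpos : 0 < d := by positivity
  have hmem := hconv.sum_mem (t := Finset.univ)
    (w := ![det2 b c p / d, det2 c a p / d, det2 a b p / d]) (z := ![a, b, c])
    (by intro i _; fin_cases i <;> simp <;> positivity)
    (by simp [Fin.sum_univ_three]; field_simp; rw [hd]; ring)
    (by
      intro i _
      fin_cases i
      · exact hsub ⟨ha, hpa⟩
      · exact hsub ⟨hb, hpb⟩
      · exact hsub ⟨hc, hpc⟩)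
  convert hmem using 1
  simp only [Fin.sum_univ_three]
  ext
  · simp
    field_simp
    rw [hd]; unfold det2; ring
  · simp
    field_simp
    rw [hd]; unfold det2; ring

theorem turn_trans_left {s : ℝ} {a b c d : ℝ × ℝ} (hab : a.1 < b.1) (hbc : b.1 < c.1)
    (hcd : c.1 < d.1) (h1 : 0 < s * det2 a b c) (h2 : 0 < s * det2 b c d) :
    0 < s * det2 a b d := by
  have key : s * det2 a b d * (c.1 - b.1) =
      s * det2 a b c * (d.1 - b.1) + s * det2 b c d * (b.1 - a.1) := by
    unfold det2; ring
  have hp : 0 < s * det2 a b d * (c.1 - b.1) := by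
    rw [key]
    have := sub_pos.2 hab
    have := sub_pos.2 (hbc.trans hcd)
    positivity
  exact pos_of_mul_pos_left hp (sub_pos.2 hbc).le

theorem turn_trans_right {s : ℝ} {a b c d : ℝ × ℝ} (hab : a.1 < b.1) (hbc : b.1 < c.1)
    (hcd : c.1 < d.1) (h1 : 0 < s * det2 a b c) (h2 : 0 < s * det2 b c d) :
    0 < s * det2 a c d := by
  have key : s * det2 a c d * (c.1 - b.1) =
      s * det2 a b c * (d.1 - c.1) + s * det2 b c d * (c.1 - a.1) := by
    unfold det2; ring
  have hp : 0 < s * det2 a c d * (c.1 - b.1) := by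
    rw [key]
    have := sub_pos.2 hcd
    have := sub_pos.2 (hab.trans hbc)
    positivity
  exact pos_of_mul_pos_left hp (sub_pos.2 hbc).le

theorem Turns.convexPos {s : ℝ} {T : Finset (ℝ × ℝ)}
    (hinj : Set.InjOn Prod.fst (T : Set (ℝ × ℝ))) (h : Turns s T) :
    ConvexPos (T : Set (ℝ × ℝ)) := by
  classical
  intro p hp hmem
  rw [Finset.mem_coe] at hp
  let g : ℝ × ℝ → ℝ := fun q => s * (q.2 - p.2) / (q.1 - p.1)
  obtain ⟨m, hlo, hhi⟩ := Order.exists_between_finsets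
    ((T.filter fun q => q.1 < p.1).image g) ((T.filter fun q => p.1 < q.1).image g)
    (by
      intro x hx y hy
      simp only [Finset.mem_image, Finset.mem_filter] at hx hy
      obtain ⟨a, ⟨ha, hap⟩, rfl⟩ := hx
      obtain ⟨c, ⟨hc, hpc⟩, rfl⟩ := hy
      have hd := h a ha p hp c hc hap hpc
      have h1 := sub_pos.2 hap
      have h2 := sub_pos.2 hpc
      have e : g a = s * (p.2 - a.2) / (p.1 - a.1) := by
        simp only [g]
        rw [← neg_sub p.1 a.1, div_neg, ← neg_div]
        ring
      rw [e]
      simp only [g]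
      rw [div_lt_div_iff₀ h1 h2]
      unfold det2 at hd
      nlinarith)
  have hhalf : ((T : Set (ℝ × ℝ)) \ {p}) ⊆ {q | m * (q.1 - p.1) < s * (q.2 - p.2)} := by
    rintro q ⟨hq, hqp⟩
    rw [Finset.mem_coe] at hq
    simp only [Set.mem_ofPred_eq]
    rcases lt_or_gt_of_ne fun e => hqp (hinj hq hp e) with hlt | hlt
    · have := hlo (g q) (Finset.mem_image_of_mem _ (by simp [hq, hlt]))
      simp only [g] at this
      rwa [div_lt_iff_of_neg (sub_neg.2 hlt)] at this
    · have := hhi (g q) (Finset.mem_image_of_mem _ (by simp [hq, hlt]))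
      simp only [g] at this
      rwa [lt_div_iff₀ (sub_pos.2 hlt)] at this
  have hconv : Convex ℝ {q : ℝ × ℝ | m * (q.1 - p.1) < s * (q.2 - p.2)} := by
    intro x hx y hy u v hu hv huv
    simp only [Set.mem_ofPred_eq, Prod.fst_add, Prod.smul_fst, Prod.snd_add, Prod.smul_snd,
      smul_eq_mul] at hx hy ⊢
    obtain rfl : v = 1 - u := by linarith
    rcases hu.eq_or_lt with rfl | hu
    · linarith
    · nlinarith [mul_lt_mul_of_pos_left hx hu, mul_le_mul_of_nonneg_left hy.le hv]
  have := convexHull_min hhalf hconv hmem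
  simp at this

theorem Turns.insert_right {s : ℝ} {T : Finset (ℝ × ℝ)} {p q r : ℝ × ℝ}
    (hinj : Set.InjOn Prod.fst (T : Set (ℝ × ℝ))) (h : Turns s T)
    (hp : p ∈ T) (hpmax : ∀ x ∈ T, x.1 ≤ p.1) (hq : q ∈ T) (hqp : q.1 < p.1)
    (hqmax : ∀ x ∈ T, x ≠ p → x.1 ≤ q.1) (hpr : p.1 < r.1) (hturn : 0 < s * det2 q p r) :
    Turns s (insert r T) := by
  have hlast : ∀ x ∈ T, x.1 < p.1 → 0 < s * det2 x p r := by
    intro x hx hxp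
    rcases (hqmax x hx (by rintro rfl; exact lt_irrefl _ hxp)).eq_or_lt with e | hlt
    · rwa [hinj hx hq e]
    · exact turn_trans_right hlt hqp hpr (h x hx q hq p hp hlt hqp) hturn
  intro a ha b hb c hc hab hbc
  rw [Finset.mem_insert] at ha hb hc
  have hle : ∀ x, x = r ∨ x ∈ T → x.1 ≤ r.1 := by
    rintro x (rfl | hx)
    · exact le_rfl
    · exact (hpmax x hx).trans hpr.le
  have hbT : b ∈ T := hb.resolve_left
    (by rintro rfl; exact absurd (hle c hc) (not_le.2 hbc))
  have haT : a ∈ T := ha.resolve_left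
    (by rintro rfl; exact absurd (hle b hb) (not_le.2 hab))
  rcases hc with rfl | hcT
  · rcases (hpmax b hbT).eq_or_lt with e | hlt
    · obtain rfl := hinj hbT hp e
      exact hlast a haT hab
    · exact turn_trans_left hab hlt hpr (h a haT b hbT p hp hab hlt) (hlast b hbT hlt)
  · exact h a haT b hbT c hcT hab hbc

theorem Turns.insert_left {s : ℝ} {T : Finset (ℝ × ℝ)} {p q r : ℝ × ℝ}
    (hinj : Set.InjOn Prod.fst (T : Set (ℝ × ℝ))) (h : Turns s T)
    (hp : p ∈ T) (hpmin : ∀ x ∈ T, p.1 ≤ x.1) (hq : q ∈ T) (hpq : p.1 < q.1)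
    (hqmin : ∀ x ∈ T, x ≠ p → q.1 ≤ x.1) (hrp : r.1 < p.1) (hturn : 0 < s * det2 r p q) :
    Turns s (insert r T) := by
  have hfirst : ∀ x ∈ T, p.1 < x.1 → 0 < s * det2 r p x := by
    intro x hx hpx
    rcases (hqmin x hx (by rintro rfl; exact lt_irrefl _ hpx)).eq_or_lt with e | hlt
    · rwa [← hinj hq hx e]
    · exact turn_trans_left hrp hpq hlt hturn (h p hp q hq x hx hpq hlt)
  intro a ha b hb c hc hab hbc
  rw [Finset.mem_insert] at ha hb hc
  have hle : ∀ x, x = r ∨ x ∈ T → r.1 ≤ x.1 := by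
    rintro x (rfl | hx)
    · exact le_rfl
    · exact hrp.le.trans (hpmin x hx)
  have hbT : b ∈ T := hb.resolve_left
    (by rintro rfl; exact absurd (hle a ha) (not_le.2 hab))
  have hcT : c ∈ T := hc.resolve_left
    (by rintro rfl; exact absurd (hle b hb) (not_le.2 hbc))
  rcases ha with rfl | haT
  · rcases (hpmin b hbT).eq_or_lt with e | hlt
    · obtain rfl := hinj hp hbT e
      exact hfirst c hcT hbc
    · exact turn_trans_right hrp hlt hbc (hfirst b hbT hlt) (h p hp b hbT c hcT hlt hbc)
  · exact h a haT b hbT c hcT hab hbc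

theorem turns_of_card_le_two {s : ℝ} {T : Finset (ℝ × ℝ)} (h : T.card ≤ 2) : Turns s T := by
  classical
  intro a ha b hb c hc hab hbc
  have hsub : ({a, b, c} : Finset (ℝ × ℝ)) ⊆ T := by
    intro x hx
    simp only [Finset.mem_insert, Finset.mem_singleton] at hx
    rcases hx with rfl | rfl | rfl <;> assumption
  have h3 : ({a, b, c} : Finset (ℝ × ℝ)).card = 3 :=
    Finset.card_eq_three.2 ⟨a, b, c, by rintro rfl; exact lt_irrefl _ hab,
      by rintro rfl; exact lt_asymm hab hbc, by rintro rfl; exact lt_irrefl _ hbc, rfl⟩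
  have := Finset.card_le_card hsub
  omega

/-- The cups-caps theorem of Erdős and Szekeres. -/
theorem exists_cup_or_cap (m : ℕ) : ∀ n (X : Finset (ℝ × ℝ)), Generic X →
    (m + n).choose m < X.card →
    (∃ T ⊆ X, Turns 1 T ∧ T.card = m + 2) ∨ ∃ T ⊆ X, Turns (-1) T ∧ T.card = n + 2 := by
  classical
  induction m with
  | zero =>
    intro n X _ hcard
    obtain ⟨T, hT, hc⟩ := Finset.exists_subset_card_eq (s := X) (n := 2) (by simp at hcard; omega)
    exact Or.inl ⟨T, hT, turns_of_card_le_two hc.le, hc⟩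
  | succ m ihm =>
    intro n
    induction n with
    | zero =>
      intro X _ hcard
      obtain ⟨T, hT, hc⟩ := Finset.exists_subset_card_eq (s := X) (n := 2)
        (by simp at hcard; omega)
      exact Or.inr ⟨T, hT, turns_of_card_le_two hc.le, hc⟩
    | succ n ihn =>
      intro X hX hcard
      let Y := X.filter fun p => ∃ T ⊆ X, Turns 1 T ∧ T.card = m + 2 ∧ p ∈ T ∧ ∀ x ∈ T, x.1 ≤ p.1
      have hYX : Y ⊆ X := Finset.filter_subset _ _
      have hsplit : (X \ Y).card + Y.card = X.card := Finset.card_sdiff_add_card_eq_card hYX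
      have hchoose : (m + 1 + (n + 1)).choose (m + 1) =
          (m + (n + 1)).choose m + (m + 1 + n).choose (m + 1) := by
        rw [show m + 1 + (n + 1) = (m + (n + 1)) + 1 by ring, Nat.choose_succ_succ,
          show m + 1 + n = m + (n + 1) by ring]
      rcases lt_or_ge ((m + (n + 1)).choose m) (X \ Y).card with hlt | hge
      · rcases ihm (n + 1) (X \ Y) (hX.subset Finset.sdiff_subset) hlt with
          ⟨T, hT, hturn, hc⟩ | ⟨T, hT, hturn, hc⟩
        · exfalso
          obtain ⟨p, hp, hmax⟩ := T.exists_max_image Prod.fst (Finset.card_pos.1 (by omega))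
          refine (Finset.mem_sdiff.1 (hT hp)).2 (Finset.mem_filter.2 ⟨?_, T, ?_⟩)
          · exact (Finset.mem_sdiff.1 (hT hp)).1
          · exact ⟨hT.trans Finset.sdiff_subset, hturn, hc, hp, hmax⟩
        · exact Or.inr ⟨T, hT.trans Finset.sdiff_subset, hturn, hc⟩
      · rcases ihn Y (hX.subset hYX) (by omega) with ⟨T, hT, hturn, hc⟩ | ⟨V, hV, hVturn, hVc⟩
        · exact Or.inl ⟨T, hT.trans hYX, hturn, hc⟩
        · obtain ⟨p, hpV, hpmin⟩ := V.exists_min_image Prod.fst (Finset.card_pos.1 (by omega))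
          obtain ⟨-, U, hUX, hUturn, hUc, hpU, hpmax⟩ := Finset.mem_filter.1 (hV hpV)
          have hVX := hV.trans hYX
          have hVinj := (hX.subset hVX).1
          have hUinj := (hX.subset hUX).1
          obtain ⟨r, hr, hrmin⟩ := (V.erase p).exists_min_image Prod.fst
            (Finset.card_pos.1 (by rw [Finset.card_erase_of_mem hpV]; omega))
          obtain ⟨q, hq, hqmax⟩ := (U.erase p).exists_max_image Prod.fst
            (Finset.card_pos.1 (by rw [Finset.card_erase_of_mem hpU]; omega))
          obtain ⟨hrp, hrV⟩ := Finset.mem_erase.1 hr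
          obtain ⟨hqp, hqU⟩ := Finset.mem_erase.1 hq
          have hpr : p.1 < r.1 :=
            (hpmin r hrV).lt_of_ne fun e => hrp (hVinj hrV hpV e.symm)
          have hqp' : q.1 < p.1 := (hpmax q hqU).lt_of_ne fun e => hqp (hUinj hqU hpU e)
          rcases lt_or_gt_of_ne
            (hX.2 q (hUX hqU) p (hUX hpU) r (hVX hrV) hqp' hpr) with hneg | hpos
          · refine Or.inr ⟨insert q V, Finset.insert_subset (hUX hqU) hVX, ?_, ?_⟩
            · exact hVturn.insert_left hVinj hpV hpmin hrV hpr
                (fun x hx hxp => hrmin x (Finset.mem_erase.2 ⟨hxp, hx⟩)) hqp' (by linarith)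
            · rw [Finset.card_insert_of_notMem
                fun hqV => absurd (hpmin q hqV) (not_le.2 hqp'), hVc]
          · refine Or.inl ⟨insert r U, Finset.insert_subset (hVX hrV) hUX, ?_, ?_⟩
            · exact hUturn.insert_right hUinj hpU hpmax hqU hqp'
                (fun x hx hxp => hqmax x (Finset.mem_erase.2 ⟨hxp, hx⟩)) hpr (by linarith)
            · rw [Finset.card_insert_of_notMem
                fun hrU => absurd (hpmax r hrU) (not_le.2 hpr), hUc]

/-- A finite set in general position has a generic subset of at least half its size. -/
theorem GenPos.exists_generic_subset {S : Finset (ℝ × ℝ)} (h : GenPos (S : Set (ℝ × ℝ))) :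
    ∃ X ⊆ S, Generic X ∧ S.card ≤ 2 * X.card := by
  classical
  have hfiber : S.card ≤ 2 * (S.image Prod.fst).card := by
    refine Finset.card_le_mul_card_image S 2 fun x _ => ?_
    by_contra! hlt
    obtain ⟨a, b, c, ha, hb, hc, hab, hac, hbc⟩ := Finset.two_lt_card_iff.1 hlt
    simp only [Finset.mem_filter] at ha hb hc
    exact h a ha.1 b hb.1 c hc.1 hab hac hbc
      (collinear_of_fst_eq (hb.2.trans ha.2.symm) (hc.2.trans ha.2.symm))
  obtain ⟨X, hXS, hinj, himg⟩ :=
    (Set.surjOn_image Prod.fst (S : Set (ℝ × ℝ))).exists_subset_injOn_image_eq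
  lift X to Finset (ℝ × ℝ) using S.finite_toSet.subset hXS
  rw [Finset.coe_subset] at hXS
  replace himg : X.image Prod.fst = S.image Prod.fst := by exact_mod_cast himg
  refine ⟨X, hXS, ⟨hinj, ?_⟩, ?_⟩
  · intro a ha b hb c hc hab hbc h0
    exact h a (hXS ha) b (hXS hb) c (hXS hc) (by rintro rfl; exact lt_irrefl _ hab)
      (by rintro rfl; exact lt_asymm hab hbc) (by rintro rfl; exact lt_irrefl _ hbc)
      (collinear_of_det2_eq_zero hab.ne h0)
  · rwa [← himg, Finset.card_image_of_injOn hinj] at hfiber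

/-- The Erdős–Szekeres theorem: large sets in general position contain `k` points in convex
position. -/
theorem GenPos.hasConvex_of_card {k : ℕ} (hk : 2 ≤ k) {S : Finset (ℝ × ℝ)}
    (h : GenPos (S : Set (ℝ × ℝ))) (hcard : 2 * (k - 2 + (k - 2)).choose (k - 2) < S.card) :
    HasConvex (S : Set (ℝ × ℝ)) k := by
  obtain ⟨X, hXS, hX, hc⟩ := h.exists_generic_subset
  rcases exists_cup_or_cap (k - 2) (k - 2) X hX (by omega) with
    ⟨T, hT, hturn, hTc⟩ | ⟨T, hT, hturn, hTc⟩ <;>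
  exact ⟨T, Finset.coe_subset.2 (hT.trans hXS), by rw [Set.ncard_coe_finset]; omega,
    hturn.convexPos (hX.subset hT).1⟩

/-- `S` is generic, its cups have at most `u` points, its caps at most `c` points, and its subsets
without interior points at most `v` points. -/
structure Bounded (S : Finset (ℝ × ℝ)) (u c v : ℕ) : Prop where
  generic : Generic S
  cup : ∀ T ⊆ S, Turns 1 T → T.card ≤ u
  cap : ∀ T ⊆ S, Turns (-1) T → T.card ≤ c
  conv : ∀ T ⊆ S, NoInterior T → T.card ≤ v

theorem Bounded.mono {S : Finset (ℝ × ℝ)} {u c v u' c' v' : ℕ} (h : Bounded S u c v)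
    (hu : u ≤ u') (hc : c ≤ c') (hv : v ≤ v') : Bounded S u' c' v' :=
  ⟨h.generic, fun T hT ht => (h.cup T hT ht).trans hu, fun T hT ht => (h.cap T hT ht).trans hc,
    fun T hT ht => (h.conv T hT ht).trans hv⟩

theorem bounded_singleton (p : ℝ × ℝ) : Bounded {p} 1 1 1 := by
  refine ⟨⟨by simp, ?_⟩, fun T hT _ => ?_, fun T hT _ => ?_, fun T hT _ => ?_⟩
  · intro a ha b hb c hc hab
    rw [Finset.mem_singleton] at ha hb
    subst ha hb
    exact absurd hab (lt_irrefl _)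
  all_goals simpa using Finset.card_le_card hT

theorem det2_add_right (a b c w : ℝ × ℝ) : det2 (a + w) (b + w) (c + w) = det2 a b c := by
  simp [det2]

theorem Bounded.translate {S : Finset (ℝ × ℝ)} {u c v : ℕ} (h : Bounded S u c v) (w : ℝ × ℝ) :
    Bounded (S.map (addRightEmbedding w)) u c v := by
  refine ⟨⟨?_, ?_⟩, fun T hT ht => ?_, fun T hT ht => ?_, fun T hT ht => ?_⟩
  · intro a ha b hb hab
    simp only [Finset.coe_map, Set.mem_image, addRightEmbedding_apply] at ha hb
    obtain ⟨a, ha, rfl⟩ := ha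
    obtain ⟨b, hb, rfl⟩ := hb
    rw [h.generic.1 ha hb (by simpa using hab)]
  · simp only [Finset.forall_mem_map, addRightEmbedding_apply, det2_add_right]
    intro a ha b hb c hc hab hbc
    exact h.generic.2 a ha b hb c hc (by simpa using hab) (by simpa using hbc)
  all_goals
    obtain ⟨U, hU, rfl⟩ := Finset.subset_map_iff.1 hT
    rw [Finset.card_map]
  · refine h.cup U hU ?_
    simpa only [Turns, Finset.forall_mem_map, addRightEmbedding_apply, det2_add_right,
      Prod.fst_add, add_lt_add_iff_right] using ht
  · refine h.cap U hU ?_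
    simpa only [Turns, Finset.forall_mem_map, addRightEmbedding_apply, det2_add_right,
      Prod.fst_add, add_lt_add_iff_right] using ht
  · refine h.conv U hU ?_
    simpa only [NoInterior, Finset.forall_mem_map, addRightEmbedding_apply,
      det2_add_right] using ht

/-- `R` lies to the right of `L` and deep below it: every line through two points of `L` passes
above `R`, and every line through two points of `R` passes below `L`. -/
structure DeepBelow (R L : Finset (ℝ × ℝ)) : Prop where
  lt : ∀ a ∈ L, ∀ b ∈ R, a.1 < b.1
  left : ∀ a ∈ L, ∀ b ∈ L, ∀ c ∈ R, a.1 < b.1 → det2 a b c < 0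
  right : ∀ a ∈ L, ∀ b ∈ R, ∀ c ∈ R, b.1 < c.1 → 0 < det2 a b c

theorem exists_translate_deepBelow (L R : Finset (ℝ × ℝ)) :
    ∃ w : ℝ × ℝ, DeepBelow (R.map (addRightEmbedding w)) L := by
  have hM : ∀ᶠ M : ℝ in Filter.atTop, ∀ a ∈ L, ∀ b ∈ R, a.1 < b.1 + M := by
    simp only [Finset.eventually_all]
    intro a _ b _
    filter_upwards [Filter.eventually_gt_atTop (a.1 - b.1)] with M hM
    linarith
  obtain ⟨M, hM⟩ := hM.exists
  have hleft : ∀ᶠ H : ℝ in Filter.atTop, ∀ a ∈ L, ∀ b ∈ L, ∀ c ∈ R, a.1 < b.1 →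
      det2 a b (c + (M, -H)) < 0 := by
    simp only [Finset.eventually_all]
    intro a _ b _ c _
    by_cases hab : a.1 < b.1
    · filter_upwards [Filter.eventually_gt_atTop (det2 a b (c + (M, 0)) / (b.1 - a.1))]
        with H hH _
      rw [div_lt_iff₀ (sub_pos.2 hab)] at hH
      simp only [det2, Prod.fst_add, Prod.snd_add] at hH ⊢
      nlinarith
    · simp [hab]
  have hright : ∀ᶠ H : ℝ in Filter.atTop, ∀ a ∈ L, ∀ b ∈ R, ∀ c ∈ R, b.1 < c.1 →
      0 < det2 a (b + (M, -H)) (c + (M, -H)) := by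
    simp only [Finset.eventually_all]
    intro a _ b _ c _
    by_cases hbc : b.1 < c.1
    · filter_upwards [Filter.eventually_gt_atTop
        (-det2 a (b + (M, 0)) (c + (M, 0)) / (c.1 - b.1))] with H hH _
      rw [div_lt_iff₀ (sub_pos.2 hbc)] at hH
      simp only [det2, Prod.fst_add, Prod.snd_add] at hH ⊢
      nlinarith
    · simp [hbc]
  obtain ⟨H, hl, hr⟩ := (hleft.and hright).exists
  refine ⟨(M, -H), ?_, ?_, ?_⟩ <;>
    simp only [Finset.forall_mem_map, addRightEmbedding_apply, Prod.fst_add, add_lt_add_iff_right]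
  · exact hM
  · exact hl
  · exact hr

theorem DeepBelow.disjoint {L R : Finset (ℝ × ℝ)} (h : DeepBelow R L) : Disjoint L R :=
  Finset.disjoint_left.2 fun a ha hb => lt_irrefl _ (h.lt a ha a hb)

theorem DeepBelow.generic {L R : Finset (ℝ × ℝ)} (h : DeepBelow R L) (hL : Generic L)
    (hR : Generic R) : Generic (L ∪ R) := by
  constructor
  · intro a ha b hb e
    rw [Finset.mem_coe, Finset.mem_union] at ha hb
    rcases ha with ha | ha <;> rcases hb with hb | hb
    · exact hL.1 ha hb e
    · exact absurd e (h.lt a ha b hb).ne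
    · exact absurd e (h.lt b hb a ha).ne'
    · exact hR.1 ha hb e
  · intro a ha b hb c hc hab hbc
    rw [Finset.mem_union] at ha hb hc
    rcases ha with ha | ha <;> rcases hb with hb | hb <;> rcases hc with hc | hc
    · exact hL.2 a ha b hb c hc hab hbc
    · exact (h.left a ha b hb c hc hab).ne
    · exact absurd hbc (h.lt c hc b hb).not_gt
    · exact (h.right a ha b hb c hc hbc).ne'
    · exact absurd hab (h.lt b hb a ha).not_gt
    · exact absurd hab (h.lt b hb a ha).not_gt
    · exact absurd hbc (h.lt c hc b hb).not_gt
    · exact hR.2 a ha b hb c hc hab hbc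

theorem Generic.card_le_one {S T : Finset (ℝ × ℝ)} (hS : Generic S) (hT : T ⊆ S)
    (h : ∀ a ∈ T, ∀ b ∈ T, ¬ a.1 < b.1) : T.card ≤ 1 := by
  refine Finset.card_le_one.2 fun a ha b hb => ?_
  by_contra hab
  rcases hS.fst_lt_or_lt (hT ha) (hT hb) hab with hlt | hlt
  · exact h a ha b hb hlt
  · exact h b hb a ha hlt

theorem card_le_of_subset_union {α : Type*} [DecidableEq α] {L R T : Finset α} {l r x y : ℕ}
    (hT : T ⊆ L ∪ R) (hl : T ⊆ L → T.card ≤ l) (hr : T ⊆ R → T.card ≤ r)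
    (hx : (T ∩ R).Nonempty → (T ∩ L).card ≤ x) (hy : (T ∩ L).Nonempty → (T ∩ R).card ≤ y) :
    T.card ≤ max (max l r) (x + y) := by
  have hunion : T = T ∩ L ∪ T ∩ R := by
    rw [← Finset.inter_union_distrib_left, Finset.inter_eq_left.2 hT]
  rcases (T ∩ L).eq_empty_or_nonempty with hL | hL
  · rw [hL, Finset.empty_union] at hunion
    have := hr (Finset.inter_eq_left.1 hunion.symm)
    omega
  rcases (T ∩ R).eq_empty_or_nonempty with hR | hR
  · rw [hR, Finset.union_empty] at hunion
    have := hl (Finset.inter_eq_left.1 hunion.symm)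
    omega
  have hc := Finset.card_union_le (T ∩ L) (T ∩ R)
  rw [← hunion] at hc
  have := hx hR
  have := hy hL
  omega

theorem DeepBelow.bounded {L R : Finset (ℝ × ℝ)} {u₁ c₁ v₁ u₂ c₂ v₂ : ℕ} (h : DeepBelow R L)
    (hL : Bounded L u₁ c₁ v₁) (hR : Bounded R u₂ c₂ v₂) :
    Bounded (L ∪ R) (max (max u₁ u₂) (1 + u₂)) (max (max c₁ c₂) (c₁ + 1))
      (max (max v₁ v₂) (c₁ + u₂)) := by
  refine ⟨h.generic hL.generic hR.generic, fun T hT ht => ?_, fun T hT ht => ?_,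
    fun T hT ht => ?_⟩
  · refine card_le_of_subset_union hT (fun hs => hL.cup T hs ht) (fun hs => hR.cup T hs ht) ?_ ?_
    · rintro ⟨c, hc⟩
      refine hL.generic.card_le_one Finset.inter_subset_right fun a ha b hb hab => ?_
      rw [Finset.mem_inter] at ha hb hc
      have h1 := ht a ha.1 b hb.1 c hc.1 hab (h.lt b hb.2 c hc.2)
      have h2 := h.left a ha.2 b hb.2 c hc.2 hab
      linarith
    · exact fun _ => hR.cup _ Finset.inter_subset_right (ht.subset Finset.inter_subset_left)
  · refine card_le_of_subset_union hT (fun hs => hL.cap T hs ht) (fun hs => hR.cap T hs ht) ?_ ?_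
    · exact fun _ => hL.cap _ Finset.inter_subset_right (ht.subset Finset.inter_subset_left)
    · rintro ⟨a, ha⟩
      refine hR.generic.card_le_one Finset.inter_subset_right fun b hb c hc hbc => ?_
      rw [Finset.mem_inter] at ha hb hc
      have h1 := ht a ha.1 b hb.1 c hc.1 (h.lt a ha.2 b hb.2) hbc
      have h2 := h.right a ha.2 b hb.2 c hc.2 hbc
      linarith
  · refine card_le_of_subset_union hT (fun hs => hL.conv T hs ht) (fun hs => hR.conv T hs ht) ?_ ?_
    · rintro ⟨d, hd⟩
      refine hL.cap _ Finset.inter_subset_right fun a ha b hb c hc hab hbc => ?_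
      rw [Finset.mem_inter] at ha hb hc hd
      by_contra hneg
      have hpos : 0 < det2 a b c :=
        lt_of_le_of_ne (by linarith) (hL.generic.2 a ha.2 b hb.2 c hc.2 hab hbc).symm
      have h1 := h.left a ha.2 b hb.2 d hd.2 hab
      have h2 := h.left b hb.2 c hc.2 d hd.2 hbc
      refine ht a ha.1 d hd.1 c hc.1 b hb.1 ?_ ?_ ?_ <;> unfold det2 at * <;> linarith
    · rintro ⟨a, ha⟩
      refine hR.cup _ Finset.inter_subset_right fun b hb c hc d hd hbc hcd => ?_
      rw [Finset.mem_inter] at ha hb hc hd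
      by_contra hneg
      have hpos : det2 b c d < 0 :=
        lt_of_le_of_ne (by linarith) (hR.generic.2 b hb.2 c hc.2 d hd.2 hbc hcd)
      have h1 := h.right a ha.2 b hb.2 c hc.2 hbc
      have h2 := h.right a ha.2 c hc.2 d hd.2 hcd
      refine ht a ha.1 b hb.1 d hd.1 c hc.1 ?_ ?_ ?_ <;> unfold det2 at * <;> linarith

theorem Bounded.exists_union {L R : Finset (ℝ × ℝ)} {u₁ c₁ v₁ u₂ c₂ v₂ : ℕ}
    (hL : Bounded L u₁ c₁ v₁) (hR : Bounded R u₂ c₂ v₂) :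
    ∃ S : Finset (ℝ × ℝ), S.card = L.card + R.card ∧
      Bounded S (max (max u₁ u₂) (1 + u₂)) (max (max c₁ c₂) (c₁ + 1))
        (max (max v₁ v₂) (c₁ + u₂)) := by
  obtain ⟨w, hw⟩ := exists_translate_deepBelow L R
  refine ⟨L ∪ R.map (addRightEmbedding w), ?_, hw.bounded hL (hR.translate w)⟩
  rw [Finset.card_union_of_disjoint hw.disjoint, Finset.card_map]

/-- The extremal sets for the cups-caps theorem. -/
theorem exists_bounded_choose (m : ℕ) : ∀ n, ∃ S : Finset (ℝ × ℝ),
    S.card = (m + n).choose m ∧ Bounded S (m + 1) (n + 1) (m + n + 1) := by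
  induction m with
  | zero =>
    exact fun n => ⟨{0}, by simp, (bounded_singleton 0).mono (by omega) (by omega) (by omega)⟩
  | succ m ihm =>
    intro n
    induction n with
    | zero => exact ⟨{0}, by simp, (bounded_singleton 0).mono (by omega) (by omega) (by omega)⟩
    | succ n ihn =>
      obtain ⟨L, hLc, hL⟩ := ihn
      obtain ⟨R, hRc, hR⟩ := ihm (n + 1)
      obtain ⟨S, hSc, hS⟩ := hL.exists_union hR
      refine ⟨S, ?_, hS.mono (by omega) (by omega) (by omega)⟩
      rw [hSc, hLc, hRc, show m + 1 + (n + 1) = (m + (n + 1)) + 1 by ring, Nat.choose_succ_succ,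
        show m + 1 + n = m + (n + 1) by ring, add_comm]

theorem exists_bounded_sum_choose (n : ℕ) : ∀ j ≤ n, ∃ (S : Finset (ℝ × ℝ)) (u : ℕ),
    S.card = ∑ i ∈ Finset.range (j + 1), n.choose i ∧ Bounded S u (j + 1) (n + 1) := by
  intro j
  induction j with
  | zero =>
    exact fun _ => ⟨{0}, 1, by simp, (bounded_singleton 0).mono le_rfl (by omega) (by omega)⟩
  | succ j ih =>
    intro hj
    obtain ⟨L, u, hLc, hL⟩ := ih (by omega)
    obtain ⟨R, hRc, hR⟩ := exists_bounded_choose (n - (j + 1)) (j + 1)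
    obtain ⟨S, hSc, hS⟩ := hL.exists_union hR
    refine ⟨S, _, ?_, hS.mono le_rfl (by omega) (by omega)⟩
    rw [hSc, hLc, hRc, Finset.sum_range_succ _ (j + 1), Nat.sub_add_cancel hj,
      Nat.choose_symm hj]

theorem exists_genPos_not_hasConvex (n : ℕ) : ∃ S : Finset (ℝ × ℝ),
    S.card = 2 ^ n ∧ GenPos (S : Set (ℝ × ℝ)) ∧ ¬ HasConvex (S : Set (ℝ × ℝ)) (n + 2) := by
  obtain ⟨S, u, hSc, hS⟩ := exists_bounded_sum_choose n n le_rfl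
  refine ⟨S, by rw [hSc, Nat.sum_range_choose], hS.generic.genPos, ?_⟩
  rintro ⟨T, hTS, hTc, hT⟩
  lift T to Finset (ℝ × ℝ) using S.finite_toSet.subset hTS
  have := hS.conv T (Finset.coe_subset.1 hTS) hT.noInterior
  rw [Set.ncard_coe_finset] at hTc
  omega

theorem stmt_10 (k : ℕ) (hk : 3 ≤ k) :
    (∃ S : Set (ℝ × ℝ), S.Finite ∧ S.ncard = 2 ^ (k - 2) ∧ GenPos S ∧
      ¬ HasConvex S k) ∧ 2 ^ (k - 2) + 1 ≤ ES k := by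
  obtain ⟨S, hSc, hgen, hconv⟩ := exists_genPos_not_hasConvex (k - 2)
  rw [Nat.sub_add_cancel (by omega)] at hconv
  have hncard : (S : Set (ℝ × ℝ)).ncard = 2 ^ (k - 2) := by rw [Set.ncard_coe_finset, hSc]
  refine ⟨⟨S, S.finite_toSet, hncard, hgen, hconv⟩, ?_⟩
  have hmem : ES k ∈ {N : ℕ | ∀ S : Set (ℝ × ℝ), S.Finite → N ≤ S.ncard → GenPos S →
      HasConvex S k} := by
    refine Nat.sInf_mem ⟨2 * (k - 2 + (k - 2)).choose (k - 2) + 1, fun U hU hcard hUgen => ?_⟩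
    lift U to Finset (ℝ × ℝ) using hU
    rw [Set.ncard_coe_finset] at hcard
    exact hUgen.hasConvex_of_card (by omega) hcard
  by_contra! hlt
  exact hconv (hmem S S.finite_toSet (by omega) hgen)
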